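/- Let R̂ and F̂ be compatible R-matrices, A a unital associative k-algebra, and M an N×N matrix over A which is a matrix of generators of M(R̂,F̂), i.e. satisfies R̂₁ M_{1̄} M_{2̄} = M_{1̄} M_{2̄} (R̂^{FF})₁, where R̂^{FF} := F̂(F̂R̂F̂^{-1})F̂^{-1}. Then for every k ≥ 1, R̂_k M_{k̄} M_{(k+1)‾} = M_{k̄} M_{(k+1)‾} (R̂^{FF})_k. -/

import Mathlib

/-! Common definitions for quantum matrix algebras `M(R̂,F̂)` in the sense of
Isaev–Ogievetsky–Pyatov, "On quantum matrix algebras satisfying the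
Cayley-Hamilton-Newton identities".

We model operators on `V^{⊗m}` (where `dim V = N`) as matrices indexed by
multi-indices `Fin m → Fin N`; entries are taken in a (possibly
noncommutative) unital associative algebra `A` over a field `K`.
Sites (tensor factors) are numbered starting from `0`, so the paper's
`X_i` is `site m (i-1) X`, and the paper's `M_{\overline{k}}` is
`Mbar m F F⁻¹ M (k-1)`. -/

namespace CHN

noncomputable section

/-- Operators on `V^{⊗m}` (`dim V = N`) with entries in a ring `A`. -/
abbrev Op (N : ℕ) (A : Type*) [Ring A] (m : ℕ) :=
  Matrix (Fin m → Fin N) (Fin m → Fin N) A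

/-- Operators on `V ⊗ V`. -/
abbrev M2 (N : ℕ) (A : Type*) [Ring A] :=
  Matrix (Fin N × Fin N) (Fin N × Fin N) A

/-- `site m i X` places the two-site operator `X` at the (0-based) tensor
factors `i, i+1` of `V^{⊗m}`, acting as the identity elsewhere.  In the
paper's 1-based notation, `X_i = site m (i-1) X`.  (Out of range it is the
identity.) -/
def site {A : Type*} [Ring A] {N : ℕ} (m i : ℕ) (X : M2 N A) : Op N A m :=
  fun a b =>
    if h : i + 1 < m then
      X (a ⟨i, Nat.lt_of_succ_lt h⟩, a ⟨i + 1, h⟩)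
          (b ⟨i, Nat.lt_of_succ_lt h⟩, b ⟨i + 1, h⟩) *
        (if ∀ j : Fin m, (j : ℕ) ≠ i → (j : ℕ) ≠ i + 1 → a j = b j then 1 else 0)
    else if a = b then 1 else 0

/-- `site1 m i X` places the one-site operator `X` at the (0-based) factor `i`. -/
def site1 {A : Type*} [Ring A] {N : ℕ} (m i : ℕ) (X : Matrix (Fin N) (Fin N) A) :
    Op N A m :=
  fun a b =>
    if h : i < m then
      X (a ⟨i, h⟩) (b ⟨i, h⟩) *
        (if ∀ j : Fin m, (j : ℕ) ≠ i → a j = b j then 1 else 0)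
    else if a = b then 1 else 0

/-- `chain m X i l = X_i X_{i+1} ⋯ X_{i+l-1}` (0-based sites, `l` factors); in
the paper's 1-based notation this is `X_{i+1 → i+l}`. -/
def chain {A : Type*} [Ring A] {N : ℕ} (m : ℕ) (X : M2 N A) (i : ℕ) :
    ℕ → Op N A m
  | 0 => 1
  | l + 1 => chain m X i l * site m (i + l) X

/-- The Yang–Baxter equation `X₁X₂X₁ = X₂X₁X₂` on `V^{⊗3}`. -/
def YB {A : Type*} [Ring A] {N : ℕ} (X : M2 N A) : Prop :=
  site 3 0 X * site 3 1 X * site 3 0 X = site 3 1 X * site 3 0 X * site 3 1 X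

/-- Compatibility of a pair of R-matrices: both Yang–Baxter equations together
with the conditions `R̂₁F̂₂F̂₁ = F̂₂F̂₁R̂₂` and `F̂₁F̂₂R̂₁ = R̂₂F̂₁F̂₂` on `V^{⊗3}`. -/
def Compatible {A : Type*} [Ring A] {N : ℕ} (R F : M2 N A) : Prop :=
  YB R ∧ YB F ∧
    site 3 0 R * site 3 1 F * site 3 0 F = site 3 1 F * site 3 0 F * site 3 1 R ∧
    site 3 0 F * site 3 1 F * site 3 0 R = site 3 1 R * site 3 0 F * site 3 1 F

/-- `Ψ` witnesses closedness of `F̂`:  `Ψ^{af}_{cg} F̂^{gb}_{fd} = δ^a_d δ^b_c`. -/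
def IsClosedPair {A : Type*} [Ring A] {N : ℕ} (F Ψ : M2 N A) : Prop :=
  ∀ a b c d : Fin N,
    (∑ f : Fin N, ∑ g : Fin N, Ψ (a, f) (c, g) * F (g, b) (f, d)) =
      if a = d ∧ b = c then 1 else 0

/-- The matrix `D`, `D^a_b := Ψ^{ac}_{bc}`. -/
def Dmat {A : Type*} [Ring A] {N : ℕ} (Ψ : M2 N A) : Matrix (Fin N) (Fin N) A :=
  fun a b => ∑ c : Fin N, Ψ (a, c) (b, c)

/-- Quantum trace (with weight `D`) over the last tensor factor. -/
def qtr1 {K : Type*} [Field K] {A : Type*} [Ring A] [Algebra K A] {N m : ℕ}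
    (D : Matrix (Fin N) (Fin N) K) (X : Op N A (m + 1)) : Op N A m :=
  fun a b => ∑ c : Fin N, ∑ e : Fin N,
    algebraMap K A (D c e) * X (Fin.snoc a e) (Fin.snoc b c)

/-- Quantum trace over the last `j` tensor factors. -/
def qtrs {K : Type*} [Field K] {A : Type*} [Ring A] [Algebra K A] {N : ℕ}
    (D : Matrix (Fin N) (Fin N) K) (m : ℕ) :
    (j : ℕ) → Op N A (m + j) → Op N A m
  | 0, X => X
  | j + 1, X => qtrs D m j (qtr1 D X)

/-- Full quantum trace `Tr_F(1,…,m)`, with values in `A`. -/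
def qtrAll {K : Type*} [Field K] {A : Type*} [Ring A] [Algebra K A] {N m : ℕ}
    (D : Matrix (Fin N) (Fin N) K) (X : Op N A m) : A :=
  ∑ a : Fin m → Fin N, ∑ b : Fin m → Fin N,
    algebraMap K A (∏ i, D (a i) (b i)) * X b a

/-- Quantum trace of a one-site operator:  `Tr_F X = Tr (D X)`. -/
def trF {K : Type*} [Field K] {A : Type*} [Ring A] [Algebra K A] {N : ℕ}
    (D : Matrix (Fin N) (Fin N) K) (X : Matrix (Fin N) (Fin N) A) : A :=
  ∑ a : Fin N, ∑ b : Fin N, algebraMap K A (D a b) * X b a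

/-- Ordinary partial trace over the last tensor factor. -/
def ptr1 {A : Type*} [Ring A] {N m : ℕ} (X : Op N A (m + 1)) : Op N A m :=
  fun a b => ∑ c : Fin N, X (Fin.snoc a c) (Fin.snoc b c)

/-- Ordinary partial trace over the last `j` tensor factors. -/
def ptrs {A : Type*} [Ring A] {N : ℕ} (m : ℕ) :
    (j : ℕ) → Op N A (m + j) → Op N A m
  | 0, X => X
  | j + 1, X => ptrs m j (ptr1 X)

/-- `Mbar m F Finv M k` is the paper's `M_{\overline{k+1}}` (0-based index `k`):
`M_{\overline{1}} := M₁` and `M_{\overline{k+1}} := F̂_k M_{\overline{k}} F̂_k⁻¹`. -/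
def Mbar {A : Type*} [Ring A] {N : ℕ} (m : ℕ) (F Finv : M2 N A)
    (M : Matrix (Fin N) (Fin N) A) : ℕ → Op N A m
  | 0 => site1 m 0 M
  | k + 1 => site m k F * Mbar m F Finv M k * site m k Finv

/-- `MbarSeg m F Finv M i l = M_{\overline{i+1}} M_{\overline{i+2}} ⋯ M_{\overline{i+l}}`,
the ordered product of `l` consecutive copies starting at 0-based index `i`.
In particular `MbarSeg m F Finv M 0 k = M_{\overline{1}} ⋯ M_{\overline{k}}`. -/
def MbarSeg {A : Type*} [Ring A] {N : ℕ} (m : ℕ) (F Finv : M2 N A)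
    (M : Matrix (Fin N) (Fin N) A) (i : ℕ) : ℕ → Op N A m
  | 0 => 1
  | l + 1 => MbarSeg m F Finv M i l * Mbar m F Finv M (i + l)

/-- The double twist `R̂^{FF} = F̂ (F̂ R̂ F̂⁻¹) F̂⁻¹`. -/
def RFF {K : Type*} [Field K] {N : ℕ} (R F : M2 N K) : M2 N K :=
  F * (F * R * F⁻¹) * F⁻¹

/-- `M` is a matrix of generators of the algebra `M(R̂,F̂)`:
`R̂₁ M_{\overline{1}} M_{\overline{2}} = M_{\overline{1}} M_{\overline{2}} (R̂^{FF})₁`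
on `V ⊗ V`. -/
def IsGenerators {K : Type*} [Field K] {A : Type*} [Ring A] [Algebra K A] {N : ℕ}
    (R F : M2 N K) (M : Matrix (Fin N) (Fin N) A) : Prop :=
  site 2 0 (R.map (algebraMap K A)) *
      MbarSeg 2 (F.map (algebraMap K A)) ((F⁻¹).map (algebraMap K A)) M 0 2 =
    MbarSeg 2 (F.map (algebraMap K A)) ((F⁻¹).map (algebraMap K A)) M 0 2 *
      site 2 0 ((RFF R F).map (algebraMap K A))

/-- Evaluation of a noncommutative polynomial `Y` in `v` variables, substituting
for the variable `x_j` the operator `R̂` placed at the (0-based) sites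
`p+j, p+j+1` of `V^{⊗m}`.  For `p = 0` this is the paper's
`Y^{(v+1)} = Y^{(v+1)}(R̂₁,…,R̂_v)`, and a general `p` gives `Y^{(p+1,v+1)}`. -/
def evalY {K : Type*} [Field K] {A : Type*} [Ring A] [Algebra K A] {N m v : ℕ}
    (R : M2 N A) (p : ℕ) (Y : FreeAlgebra K (Fin v)) : Op N A m :=
  FreeAlgebra.lift K (fun j : Fin v => site m (p + (j : ℕ)) R) Y

/-- `Ustack m R k l = R̂_{l → l+k-1} ⋯ R̂_{2 → k+1} R̂_{1 → k}` (1-based labels):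
the product of `l` descending chains of length `k`. -/
def Ustack {A : Type*} [Ring A] {N : ℕ} (m : ℕ) (R : M2 N A) (k : ℕ) :
    ℕ → Op N A m
  | 0 => 1
  | l + 1 => chain m R l k * Ustack m R k l

/-- The `q`-number `n_q = (qⁿ − q⁻ⁿ)/(q − q⁻¹)`. -/
def qInt {K : Type*} [Field K] (q : K) (n : ℕ) : K :=
  (q ^ n - q⁻¹ ^ n) / (q - q⁻¹)

/-- `R̂` is a Hecke R-matrix for the parameter `q`:  it is invertible, satisfies
the Yang–Baxter equation and the Hecke condition `R̂² = 1 + (q − q⁻¹)R̂`. -/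
def IsHecke {K : Type*} [Field K] {N : ℕ} (q : K) (R : M2 N K) : Prop :=
  IsUnit R ∧ YB R ∧ R * R = 1 + (q - q⁻¹) • R

/-- The `q`-antisymmetrizer `A^{(k)}` built from `R̂`, placed at the (0-based)
tensor factors `p, p+1, …, p+k-1` of `V^{⊗m}`. -/
def qasym {K : Type*} [Field K] {N : ℕ} (q : K) (R : M2 N K) (m p : ℕ) :
    ℕ → Op N K m
  | 0 => 1
  | 1 => 1
  | k + 2 =>
      (qInt q (k + 2))⁻¹ •
        (qasym q R m p (k + 1) *
          (q ^ (k + 1) • (1 : Op N K m) - qInt q (k + 1) • site m (p + k) R) *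
          qasym q R m p (k + 1))

/-- The `q`-symmetrizer `S^{(k)}` built from `R̂`, placed at the (0-based)
tensor factors `p, p+1, …, p+k-1` of `V^{⊗m}`. -/
def qsym {K : Type*} [Field K] {N : ℕ} (q : K) (R : M2 N K) (m p : ℕ) :
    ℕ → Op N K m
  | 0 => 1
  | 1 => 1
  | k + 2 =>
      (qInt q (k + 2))⁻¹ •
        (qsym q R m p (k + 1) *
          (q⁻¹ ^ (k + 1) • (1 : Op N K m) + qInt q (k + 1) • site m (p + k) R) *
          qsym q R m p (k + 1))

/-- The elementary symmetric function
`σ_k(M) = Tr_F(1,…,k)(A^{(k)} M_{\overline{1}}⋯M_{\overline{k}})` (with `σ_0 = 1`). -/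
def sigmaF {K : Type*} [Field K] {A : Type*} [Ring A] [Algebra K A] {N : ℕ}
    (q : K) (R F Ψ : M2 N K) (M : Matrix (Fin N) (Fin N) A) (k : ℕ) : A :=
  qtrAll (Dmat Ψ)
    ((qasym q R k 0 k).map (algebraMap K A) *
      MbarSeg k (F.map (algebraMap K A)) ((F⁻¹).map (algebraMap K A)) M 0 k)

/-- The complete symmetric function
`τ_k(M) = Tr_F(1,…,k)(S^{(k)} M_{\overline{1}}⋯M_{\overline{k}})` (with `τ_0 = 1`). -/
def tauF {K : Type*} [Field K] {A : Type*} [Ring A] [Algebra K A] {N : ℕ}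
    (q : K) (R F Ψ : M2 N K) (M : Matrix (Fin N) (Fin N) A) (k : ℕ) : A :=
  qtrAll (Dmat Ψ)
    ((qsym q R k 0 k).map (algebraMap K A) *
      MbarSeg k (F.map (algebraMap K A)) ((F⁻¹).map (algebraMap K A)) M 0 k)

/-- The power sums `s_k(M) = Tr_F(1,…,k)(R̂_{1→k−1} M_{\overline{1}}⋯M_{\overline{k}})`,
with `s_0 = 1`. -/
def sF {K : Type*} [Field K] {A : Type*} [Ring A] [Algebra K A] {N : ℕ}
    (R F Ψ : M2 N K) (M : Matrix (Fin N) (Fin N) A) : ℕ → A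
  | 0 => 1
  | j + 1 =>
      qtrAll (Dmat Ψ)
        (chain (j + 1) (R.map (algebraMap K A)) 0 j *
          MbarSeg (j + 1) (F.map (algebraMap K A)) ((F⁻¹).map (algebraMap K A)) M 0 (j + 1))

/-- The `(j+1)`-st quantum power of `M`,
`M^{\overline{j+1}} = Tr_F(2,…,j+1)(R̂_{1→j} M_{\overline{1}}⋯M_{\overline{j+1}})`,
as a one-site operator (so `MpowF R F Ψ M 0 = M₁ = M`). -/
def MpowF {K : Type*} [Field K] {A : Type*} [Ring A] [Algebra K A] {N : ℕ}
    (R F Ψ : M2 N K) (M : Matrix (Fin N) (Fin N) A) (j : ℕ) : Op N A 1 :=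
  qtrs (Dmat Ψ) 1 j
    (chain (1 + j) (R.map (algebraMap K A)) 0 j *
      MbarSeg (1 + j) (F.map (algebraMap K A)) ((F⁻¹).map (algebraMap K A)) M 0 (j + 1))

/-- The `(j+1)`-st wedge power of `M`,
`M^{∧(j+1)} = Tr_F(2,…,j+1)(A^{(j+1)} M_{\overline{1}}⋯M_{\overline{j+1}})`. -/
def MwedgeF {K : Type*} [Field K] {A : Type*} [Ring A] [Algebra K A] {N : ℕ}
    (q : K) (R F Ψ : M2 N K) (M : Matrix (Fin N) (Fin N) A) (j : ℕ) : Op N A 1 :=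
  qtrs (Dmat Ψ) 1 j
    ((qasym q R (1 + j) 0 (j + 1)).map (algebraMap K A) *
      MbarSeg (1 + j) (F.map (algebraMap K A)) ((F⁻¹).map (algebraMap K A)) M 0 (j + 1))

/-- The `(j+1)`-st symmetric power of `M`,
`M^{S(j+1)} = Tr_F(2,…,j+1)(S^{(j+1)} M_{\overline{1}}⋯M_{\overline{j+1}})`. -/
def MsymF {K : Type*} [Field K] {A : Type*} [Ring A] [Algebra K A] {N : ℕ}
    (q : K) (R F Ψ : M2 N K) (M : Matrix (Fin N) (Fin N) A) (j : ℕ) : Op N A 1 :=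
  qtrs (Dmat Ψ) 1 j
    ((qsym q R (1 + j) 0 (j + 1)).map (algebraMap K A) *
      MbarSeg (1 + j) (F.map (algebraMap K A)) ((F⁻¹).map (algebraMap K A)) M 0 (j + 1))

/-- `M^{\overline{0}} := q^{-n} n_q Tr_{(2,…,n)}(A^{(n)}) D^{-1}`, with `n = n0 + 1`
(an ordinary, non-quantum, trace over the factors `2,…,n`). -/
def MzeroF {K : Type*} [Field K] {N : ℕ} (q : K) (R Ψ : M2 N K) (n0 : ℕ) :
    Op N K 1 :=
  (q⁻¹ ^ (n0 + 1) * qInt q (n0 + 1)) •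
    (ptrs 1 n0 (qasym q R (1 + n0) 0 (n0 + 1)) * site1 1 0 ((Dmat Ψ)⁻¹))

/-- The generators of the characteristic subalgebra: all elements
`α(Y^{(k)}) = Tr_F(1,…,k)(Y^{(k)} M_{\overline{1}}⋯M_{\overline{k}})`, `k ≥ 1`. -/
def charSet {K : Type*} [Field K] {A : Type*} [Ring A] [Algebra K A] {N : ℕ}
    (R F Ψ : M2 N K) (M : Matrix (Fin N) (Fin N) A) : Set A :=
  { x : A | ∃ (v : ℕ) (Y : FreeAlgebra K (Fin v)),
      x = qtrAll (Dmat Ψ)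
        (evalY (R.map (algebraMap K A)) 0 Y *
          MbarSeg (v + 1) (F.map (algebraMap K A)) ((F⁻¹).map (algebraMap K A)) M 0 (v + 1)) }

end

/-- Splitting a multi-index over `α` into its part along the embedding `e : ι ↪ α` and its part
outside the range of `e`. -/
noncomputable def splitIndex {ι α β : Type*} (e : ι ↪ α) :
    (α → β) ≃ (ι → β) × ({x // x ∉ Set.range e} → β) := by
  classical
  exact (Equiv.piEquivPiSubtypeProd (fun x => x ∈ Set.range e) (fun _ => β)).trans
    (Equiv.prodCongr ((Equiv.ofInjective e e.injective).symm.arrowCongr (Equiv.refl β))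
      (Equiv.refl _))

/-- The operator acting as `X` on the tensor factors in the range of `e` and as the identity on
the other ones. -/
noncomputable def place {ι α β A : Type*} [Ring A] (e : ι ↪ α)
    (X : Matrix (ι → β) (ι → β) A) : Matrix (α → β) (α → β) A :=
  letI : DecidableEq ({x // x ∉ Set.range e} → β) := Classical.decEq _
  (Matrix.blockDiagonal fun _ => X).submatrix (splitIndex e) (splitIndex e)

section place

variable {ι κ α β A : Type*} [Ring A]

open scoped Classical in
theorem place_apply (e : ι ↪ α) (X : Matrix (ι → β) (ι → β) A) (a b : α → β) :
    place e X a b =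
      if ∀ j, j ∉ Set.range e → a j = b j then X (fun i => a (e i)) (fun i => b (e i)) else 0 := by
  have h1 : ∀ a : α → β, (splitIndex e a).1 = fun i => a (e i) := fun a => rfl
  have h2 : (splitIndex e a).2 = (splitIndex e b).2 ↔ ∀ j, j ∉ Set.range e → a j = b j :=
    ⟨fun h j hj => congrFun h ⟨j, hj⟩, fun h => funext fun j => h j.1 j.2⟩
  simp only [place, Matrix.submatrix_apply, Matrix.blockDiagonal_apply, h1, h2]

theorem place_mul [DecidableEq ι] [Fintype ι] [DecidableEq α] [Fintype α] [Fintype β]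
    (e : ι ↪ α) (X Y : Matrix (ι → β) (ι → β) A) :
    place e (X * Y) = place e X * place e Y := by
  let : DecidableEq ({x // x ∉ Set.range e} → β) := Classical.decEq _
  let : Fintype ({x // x ∉ Set.range e} → β) := Fintype.ofFinite _
  simp only [place]
  rw [Matrix.submatrix_mul_equiv, ← Matrix.blockDiagonal_mul]

theorem place_mul_place_apply [DecidableEq α] [Fintype α] [Fintype β] (e : ι ↪ α) (f : κ ↪ α)
    (hef : Disjoint (Set.range e) (Set.range f)) (X : Matrix (ι → β) (ι → β) A)
    (Y : Matrix (κ → β) (κ → β) A) (a b : α → β) [Decidable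
      (∀ j, j ∉ Set.range e → j ∉ Set.range f → a j = b j)] :
    (place e X * place f Y) a b =
      if ∀ j, j ∉ Set.range e → j ∉ Set.range f → a j = b j then
        X (fun i => a (e i)) (fun i => b (e i)) * Y (fun i => a (f i)) (fun i => b (f i))
      else 0 := by
  classical
  have hfe : ∀ i, f i ∉ Set.range e := fun i hi => Set.disjoint_left.1 hef hi ⟨i, rfl⟩
  have hee : ∀ i, e i ∉ Set.range f := fun i hi => Set.disjoint_left.1 hef ⟨i, rfl⟩ hi
  rw [Matrix.mul_apply, Finset.sum_eq_single fun j => if j ∈ Set.range e then b j else a j]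
  · have he : ∀ j, j ∉ Set.range e → a j = if j ∈ Set.range e then b j else a j :=
      fun j hj => by rw [if_neg hj]
    have hf : (∀ j, j ∉ Set.range f → (if j ∈ Set.range e then b j else a j) = b j) ↔
        ∀ j, j ∉ Set.range e → j ∉ Set.range f → a j = b j := by
      refine forall_congr' fun j => ?_
      by_cases hj : j ∈ Set.range e <;> simp only [hj, if_true, if_false] <;> tauto
    rw [place_apply, place_apply, if_pos he]
    simp only [hf, mul_ite, mul_zero, Set.mem_range_self, if_true, hfe, if_false]
  · intro c _ hc
    rw [place_apply, place_apply]
    split_ifs with h1 h2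
    · refine absurd (funext fun j => ?_) hc
      split_ifs with hj
      · exact h2 j (Set.disjoint_left.1 hef hj)
      · exact (h1 j hj).symm
    all_goals simp
  · simp

/-- Operators placed at disjoint sets of tensor factors commute if their entries do. -/
theorem commute_place [DecidableEq α] [Fintype α] [Fintype β] (e : ι ↪ α) (f : κ ↪ α)
    (hef : Disjoint (Set.range e) (Set.range f)) (X : Matrix (ι → β) (ι → β) A)
    (Y : Matrix (κ → β) (κ → β) A) (hXY : ∀ a b c d, Commute (X a b) (Y c d)) :
    Commute (place e X) (place f Y) := by
  classical
  ext a b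
  rw [place_mul_place_apply e f hef, place_mul_place_apply f e hef.symm, (hXY _ _ _ _).eq]
  exact if_congr (forall_congr' fun j => by tauto) rfl rfl

end place

/-- The embedding of `n` consecutive tensor factors into `m` ones, starting at `i`. -/
def shiftEmb {m : ℕ} (n i : ℕ) (h : i + n ≤ m) : Fin n ↪ Fin m where
  toFun j := ⟨i + j, by omega⟩
  inj' := fun a b hab => Fin.ext (by simpa using hab)

theorem shiftEmb_apply {m n i : ℕ} (h : i + n ≤ m) (j : Fin n) :
    shiftEmb n i h j = ⟨i + j, by omega⟩ := rfl

theorem mem_range_shiftEmb {m n i : ℕ} (h : i + n ≤ m) (j : Fin m) :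
    j ∈ Set.range (shiftEmb n i h) ↔ i ≤ j ∧ (j : ℕ) < i + n := by
  constructor
  · rintro ⟨k, rfl⟩
    simp [shiftEmb_apply]
  · rintro ⟨h1, h2⟩
    exact ⟨⟨j - i, by omega⟩, Fin.ext (by simp [shiftEmb_apply]; omega)⟩

section site

variable {A : Type*} [Ring A] {N : ℕ}

theorem place_site {m n i j : ℕ} (h : i + n ≤ m) (hj : j + 1 < n) (X : M2 N A) :
    place (shiftEmb n i h) (site n j X) = site m (i + j) X := by
  classical
  ext a b
  have hm : i + j + 1 < m := by omega
  have key : (∀ l : Fin m, (l : ℕ) ≠ i + j → (l : ℕ) ≠ i + j + 1 → a l = b l) ↔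
      (∀ l, l ∉ Set.range (shiftEmb n i h) → a l = b l) ∧
      ∀ l : Fin n, (l : ℕ) ≠ j → (l : ℕ) ≠ j + 1 →
        a (shiftEmb n i h l) = b (shiftEmb n i h l) := by
    constructor
    · intro H
      refine ⟨fun l hl => H l ?_ ?_, fun l h1 h2 => H _ ?_ ?_⟩
      · rw [mem_range_shiftEmb] at hl; omega
      · rw [mem_range_shiftEmb] at hl; omega
      · simpa [shiftEmb_apply] using h1
      · simp only [shiftEmb_apply]; omega
    · rintro ⟨H1, H2⟩ l h1 h2
      by_cases hl : l ∈ Set.range (shiftEmb n i h)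
      · obtain ⟨k, rfl⟩ := hl
        simp only [shiftEmb_apply] at h1 h2
        exact H2 k (by omega) (by omega)
      · exact H1 l hl
  rw [place_apply]
  simp only [site, dif_pos hj, dif_pos hm, key, ite_and]
  split_ifs <;> simp [shiftEmb_apply, add_assoc]

theorem place_site1 {m n i j : ℕ} (h : i + n ≤ m) (hj : j < n) (X : Matrix (Fin N) (Fin N) A) :
    place (shiftEmb n i h) (site1 n j X) = site1 m (i + j) X := by
  classical
  ext a b
  have hm : i + j < m := by omega
  have key : (∀ l : Fin m, (l : ℕ) ≠ i + j → a l = b l) ↔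
      (∀ l, l ∉ Set.range (shiftEmb n i h) → a l = b l) ∧
      ∀ l : Fin n, (l : ℕ) ≠ j → a (shiftEmb n i h l) = b (shiftEmb n i h l) := by
    constructor
    · intro H
      refine ⟨fun l hl => H l ?_, fun l h1 => H _ ?_⟩
      · rw [mem_range_shiftEmb] at hl; omega
      · simpa [shiftEmb_apply] using h1
    · rintro ⟨H1, H2⟩ l h1
      by_cases hl : l ∈ Set.range (shiftEmb n i h)
      · obtain ⟨k, rfl⟩ := hl
        simp only [shiftEmb_apply] at h1
        exact H2 k (by omega)
      · exact H1 l hl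
  rw [place_apply]
  simp only [site1, dif_pos hj, dif_pos hm, key, ite_and]
  split_ifs <;> simp [shiftEmb_apply]

theorem site_two_zero (X : M2 N A) :
    site 2 0 X = X.submatrix (finTwoArrowEquiv (Fin N)) (finTwoArrowEquiv (Fin N)) := by
  ext a b
  simp [site, finTwoArrowEquiv, Fin.forall_fin_two]

theorem site_mul {m i : ℕ} (hi : i + 2 ≤ m) (X Y : M2 N A) :
    site m i (X * Y) = site m i X * site m i Y := by
  have key (Z : M2 N A) : site m i Z = place (shiftEmb 2 i hi) (site 2 0 Z) :=
    (place_site hi (j := 0) (by norm_num) Z).symm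
  rw [key, key, key, ← place_mul]
  simp only [site_two_zero, Matrix.submatrix_mul_equiv]

theorem site_one (m i : ℕ) : site m i (1 : M2 N A) = 1 := by
  ext a b
  simp only [site, Matrix.one_apply]
  split_ifs with h1 h2 h3 h4 h4 h5 <;> simp_all
  refine absurd (funext fun j => ?_) h4
  by_cases e1 : (j : ℕ) = i
  · exact (congrArg a (Fin.ext e1)).trans (h2.1.trans (congrArg b (Fin.ext e1.symm)))
  · by_cases e2 : (j : ℕ) = i + 1
    · exact (congrArg a (Fin.ext e2)).trans (h2.2.trans (congrArg b (Fin.ext e2.symm)))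
    · exact h3 j e1 e2

theorem site_map {B : Type*} [Ring B] (f : A →+* B) (m i : ℕ) (X : M2 N A) :
    (site m i X).map f = site m i (X.map f) := by
  ext a b
  simp only [site, Matrix.map_apply]
  split_ifs <;> simp

theorem commute_site_site {m i j : ℕ} (hij : i + 2 ≤ j) (hj : j + 2 ≤ m) (X Y : M2 N A)
    (hXY : ∀ a b c d, Commute (X a b) (Y c d)) : Commute (site m i X) (site m j Y) := by
  have hi : i + 2 ≤ m := by omega
  rw [← add_zero i, ← add_zero j, ← place_site hi (by norm_num), ← place_site hj (by norm_num)]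
  refine commute_place _ _ ?_ _ _ fun a b c d => ?_
  · refine Set.disjoint_left.2 fun l h1 h2 => ?_
    rw [mem_range_shiftEmb] at h1 h2
    omega
  · rw [site_two_zero, site_two_zero]
    exact hXY _ _ _ _

theorem commute_site1_site {m i j : ℕ} (hij : i + 1 ≤ j) (hj : j + 2 ≤ m)
    (X : Matrix (Fin N) (Fin N) A) (Y : M2 N A) (hXY : ∀ a b c d, Commute (X a b) (Y c d)) :
    Commute (site1 m i X) (site m j Y) := by
  have hi : i + 1 ≤ m := by omega
  rw [← add_zero i, ← add_zero j, ← place_site1 hi (by norm_num), ← place_site hj (by norm_num)]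
  refine commute_place _ _ ?_ _ _ fun a b c d => ?_
  · refine Set.disjoint_left.2 fun l h1 h2 => ?_
    rw [mem_range_shiftEmb] at h1 h2
    omega
  · rw [site_two_zero]
    simpa [site1] using hXY _ _ _ _

theorem place_Mbar {m n : ℕ} (h : n ≤ m) (F Finv : M2 N A) (M : Matrix (Fin N) (Fin N) A) (k : ℕ)
    (hk : k < n) :
    place (shiftEmb n 0 (by omega : 0 + n ≤ m)) (Mbar n F Finv M k) = Mbar m F Finv M k := by
  induction k with
  | zero => simpa [Mbar] using place_site1 (by omega : 0 + n ≤ m) hk M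
  | succ k ih =>
    rw [Mbar, place_mul, place_mul, ih (by omega), place_site _ hk, place_site _ hk, zero_add]
    rfl

end site

section scalars

variable {K A : Type*} [Field K] [Ring A] [Algebra K A] {N : ℕ}

theorem commute_Mbar_site (F Finv Y : M2 N K) (M : Matrix (Fin N) (Fin N) A) {m k j : ℕ}
    (hkj : k + 1 ≤ j) (hj : j + 2 ≤ m) :
    Commute (Mbar m (F.map (algebraMap K A)) (Finv.map (algebraMap K A)) M k)
      (site m j (Y.map (algebraMap K A))) := by
  induction k with
  | zero => exact commute_site1_site hkj hj _ _ fun _ _ _ _ => (Algebra.commutes _ _).symm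
  | succ k ih =>
    refine Commute.mul_left (Commute.mul_left ?_ (ih (by omega))) ?_
    · exact commute_site_site hkj hj _ _ fun _ _ _ _ => Algebra.commutes _ _
    · exact commute_site_site hkj hj _ _ fun _ _ _ _ => Algebra.commutes _ _

/-- A cubic relation on `V^{⊗3}` transported to the tensor factors `k, k+1, k+2` of `V^{⊗m}`. -/
theorem site_cubic_relation {m k i₁ i₂ i₃ j₁ j₂ j₃ : ℕ} (hk : k + 3 ≤ m)
    (hi₁ : i₁ + 1 < 3) (hi₂ : i₂ + 1 < 3) (hi₃ : i₃ + 1 < 3)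
    (hj₁ : j₁ + 1 < 3) (hj₂ : j₂ + 1 < 3) (hj₃ : j₃ + 1 < 3) (X₁ X₂ X₃ Y₁ Y₂ Y₃ : M2 N K)
    (h : site 3 i₁ X₁ * site 3 i₂ X₂ * site 3 i₃ X₃ =
      site 3 j₁ Y₁ * site 3 j₂ Y₂ * site 3 j₃ Y₃) :
    site m (k + i₁) (X₁.map (algebraMap K A)) * site m (k + i₂) (X₂.map (algebraMap K A)) *
        site m (k + i₃) (X₃.map (algebraMap K A)) =
      site m (k + j₁) (Y₁.map (algebraMap K A)) * site m (k + j₂) (Y₂.map (algebraMap K A)) *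
        site m (k + j₃) (Y₃.map (algebraMap K A)) := by
  have h' := congrArg (fun Z => place (shiftEmb 3 k hk) (Z.map (algebraMap K A))) h
  simpa only [Matrix.map_mul, site_map, place_mul, place_site hk hi₁, place_site hk hi₂,
    place_site hk hi₃, place_site hk hj₁, place_site hk hj₂, place_site hk hj₃] using h'

end scalars

/-- Conjugating by `a * b` moves the quadratic relation on `x` and `a x a⁻¹` one step further. -/
theorem shift_quadratic_relation {G : Type*} [Monoid G] {a a' b b' r s x : G}
    (ha : a * a' = 1) (ha' : a' * a = 1) (hb : b * b' = 1) (hb' : b' * b = 1)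
    (hbx : x * b = b * x) (hab : a * b * a = b * a * b) (hrs : a * b * r = s * a * b)
    (hx : r * x * (a * x * a') = x * (a * x * a') * (a * (a * r * a') * a')) :
    s * (a * x * a') * (b * (a * x * a') * b') =
      a * x * a' * (b * (a * x * a') * b') * (b * (b * s * b') * b') := by
  have hu : a * b * (b' * a') = 1 := by
    rw [mul_assoc, ← mul_assoc b, hb, one_mul, ha]
  have hr : SemiconjBy (a * b) r s := by rw [SemiconjBy, hrs, mul_assoc]
  have huA : SemiconjBy (a * b) a b := by rw [SemiconjBy, hab, mul_assoc]
  have huA' : SemiconjBy (a * b) a' b' := by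
    calc a * b * a' = b' * b * (a * b) * a' := by rw [hb', one_mul]
      _ = b' * (a * b * a) * a' := by rw [hab]; simp only [mul_assoc]
      _ = b' * (a * b) * (a * a') := by simp only [mul_assoc]
      _ = b' * (a * b) := by rw [ha, mul_one]
  have hux : SemiconjBy (a * b) x (a * x * a') := by
    calc a * b * x = a * x * b := by rw [mul_assoc, ← hbx, mul_assoc]
      _ = a * x * (a' * a) * b := by rw [ha', mul_one]
      _ = a * x * a' * (a * b) := by simp only [mul_assoc]
  have huy : SemiconjBy (a * b) (a * x * a') (b * (a * x * a') * b') :=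
    (huA.mul_right hux).mul_right huA'
  have hut : SemiconjBy (a * b) (a * (a * r * a') * a') (b * (b * s * b') * b') :=
    (huA.mul_right ((huA.mul_right hr).mul_right huA')).mul_right huA'
  have hl := (hr.mul_right hux).mul_right huy
  have hrr := (hux.mul_right huy).mul_right hut
  rw [← hx] at hrr
  have := hl.eq.symm.trans hrr.eq
  simpa only [mul_assoc _ (a * b) (b' * a'), hu, mul_one] using congrArg (· * (b' * a')) this

/-- Lemma c, (17).  If `M` is a matrix of generators of
`M(R̂,F̂)`, then `R̂_k M_{\overline{k}} M_{\overline{k+1}} = M_{\overline{k}} M_{\overline{k+1}} (R̂^{FF})_k`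
for every `k ≥ 1`.  In 0-based form:  `site m k _` is the paper's `R̂_{k+1}`,
`Mbar m _ _ M k` is the paper's `M_{\overline{k+1}}`, and the bound
`k + 2 ≤ m` puts all operators inside `V^{⊗m}`. -/
theorem gen_relation_at_all_sites {K : Type} [Field K] {A : Type} [Ring A] [Algebra K A]
    {N : ℕ} (R F : M2 N K) (hR : IsUnit R) (hF : IsUnit F) (h : Compatible R F)
    (M : Matrix (Fin N) (Fin N) A) (hM : IsGenerators R F M) :
    ∀ m k : ℕ, k + 2 ≤ m →
      site m k (R.map (algebraMap K A)) *
          Mbar m (F.map (algebraMap K A)) ((F⁻¹).map (algebraMap K A)) M k *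
          Mbar m (F.map (algebraMap K A)) ((F⁻¹).map (algebraMap K A)) M (k + 1) =
        Mbar m (F.map (algebraMap K A)) ((F⁻¹).map (algebraMap K A)) M k *
          Mbar m (F.map (algebraMap K A)) ((F⁻¹).map (algebraMap K A)) M (k + 1) *
          site m k ((RFF R F).map (algebraMap K A)) := by
  set φ := algebraMap K A
  obtain ⟨-, hFYB, -, hFR⟩ := h
  have hdet : IsUnit F.det := (Matrix.isUnit_iff_isUnit_det F).1 hF
  have hone : (1 : M2 N K).map φ = 1 := Matrix.map_one _ φ.map_zero φ.map_one
  have hFF' {m k : ℕ} (hk : k + 2 ≤ m) : site m k (F.map φ) * site m k (F⁻¹.map φ) = 1 := by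
    rw [← site_mul hk, ← Matrix.map_mul, Matrix.mul_nonsing_inv F hdet, hone, site_one]
  have hF'F {m k : ℕ} (hk : k + 2 ≤ m) : site m k (F⁻¹.map φ) * site m k (F.map φ) = 1 := by
    rw [← site_mul hk, ← Matrix.map_mul, Matrix.nonsing_inv_mul F hdet, hone, site_one]
  have hRFF {m k : ℕ} (hk : k + 2 ≤ m) : site m k ((RFF R F).map φ) =
      site m k (F.map φ) * (site m k (F.map φ) * site m k (R.map φ) * site m k (F⁻¹.map φ)) *
        site m k (F⁻¹.map φ) := by
    simp only [RFF, Matrix.map_mul, site_mul hk]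
  intro m k
  induction k with
  | zero =>
    intro hm
    have hM' := congrArg (place (shiftEmb 2 0 hm)) hM
    simpa only [MbarSeg, one_mul, zero_add, place_mul, place_site hm one_lt_two,
      place_Mbar (by omega : 2 ≤ m) _ _ M 0 two_pos,
      place_Mbar (by omega : 2 ≤ m) _ _ M 1 one_lt_two, ← mul_assoc] using hM'
  | succ k ih =>
    intro hm
    have hk : k + 2 ≤ m := by omega
    have hx := ih hk
    rw [hRFF hk] at hx
    rw [hRFF hm]
    refine shift_quadratic_relation (hFF' hk) (hF'F hk) (hFF' hm) (hF'F hm)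
      (commute_Mbar_site F F⁻¹ F M le_rfl hm).eq ?_ ?_ hx
    · exact site_cubic_relation (i₁ := 0) (i₂ := 1) (i₃ := 0) (j₁ := 1) (j₂ := 0) (j₃ := 1) hm
        (by norm_num) (by norm_num) (by norm_num) (by norm_num) (by norm_num) (by norm_num)
        _ _ _ _ _ _ hFYB
    · exact site_cubic_relation (i₁ := 0) (i₂ := 1) (i₃ := 0) (j₁ := 1) (j₂ := 0) (j₃ := 1) hm
        (by norm_num) (by norm_num) (by norm_num) (by norm_num) (by norm_num) (by norm_num)
        _ _ _ _ _ _ hFR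

end CHN
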